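/- Euler's constant satisfies γ = −2·Σ_{k=0}^{∞} exp(−e^{2k+1}) + Σ_{k=1}^{∞} ((−1)^{k+1}/k!)·(1/sinh k) − 2·Σ_{k=1}^{∞} (−1)^{k+1}·Re(Γ(πik)), where Γ is the complex Gamma function. -/

import Mathlib

open Real Complex

open MeasureTheory Set Filter Topology FourierTransform

/-- The continuous piecewise linear cutoff equal to `1` left of `-1` and to `0` right of `1`. -/
noncomputable def ramp (x : ℝ) : ℝ := max 0 (min 1 ((1 - x) / 2))

lemma ramp_of_le {x : ℝ} (hx : x ≤ -1) : ramp x = 1 := by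
  unfold ramp
  rw [min_eq_left (by linarith), max_eq_right zero_le_one]

lemma ramp_of_ge {x : ℝ} (hx : 1 ≤ x) : ramp x = 0 := by
  unfold ramp
  rw [min_eq_right (by linarith), max_eq_left (by linarith)]

lemma ramp_of_mem {x : ℝ} (h₁ : -1 ≤ x) (h₂ : x ≤ 1) : ramp x = (1 - x) / 2 := by
  unfold ramp
  rw [min_eq_right (by linarith), max_eq_right (by linarith)]

lemma ramp_nonneg (x : ℝ) : 0 ≤ ramp x := le_max_left _ _

lemma ramp_le_one (x : ℝ) : ramp x ≤ 1 := max_le zero_le_one (min_le_left _ _)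

lemma continuous_ramp : Continuous ramp := by unfold ramp; fun_prop

/-- The difference of `exp (-exp x)` and the cutoff `ramp`. -/
noncomputable def rampDiff (x : ℝ) : ℝ := Real.exp (-Real.exp x) - ramp x

@[fun_prop]
lemma continuous_rampDiff : Continuous rampDiff := by
  have := continuous_ramp
  unfold rampDiff
  fun_prop

lemma abs_rampDiff_le (x : ℝ) : |rampDiff x| ≤ Real.exp (1 - |x|) := by
  have h0 : 0 < Real.exp (-Real.exp x) := Real.exp_pos _
  have h1 : Real.exp (-Real.exp x) ≤ 1 := Real.exp_le_one_iff.2 (by linarith [Real.exp_pos x])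
  unfold rampDiff
  rcases le_total x (-1) with hx | hx
  · rw [ramp_of_le hx, abs_of_nonpos (by linarith), abs_of_nonpos (by linarith : x ≤ 0)]
    have h2 := Real.add_one_le_exp (-Real.exp x)
    have h3 : Real.exp x ≤ Real.exp (1 - -x) := Real.exp_le_exp.2 (by linarith)
    linarith
  rcases le_total 1 x with hx' | hx'
  · rw [ramp_of_ge hx', sub_zero, abs_of_pos h0, abs_of_nonneg (by linarith : 0 ≤ x)]
    exact Real.exp_le_exp.2 (by linarith [Real.add_one_le_exp x])
  · have h2 : 1 ≤ Real.exp (1 - |x|) := Real.one_le_exp (by linarith [abs_le.2 ⟨hx, hx'⟩])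
    refine (abs_le.2 ⟨?_, ?_⟩).trans h2 <;> linarith [ramp_nonneg x, ramp_le_one x]

lemma integrable_exp_sub_half_abs : Integrable fun x : ℝ ↦ Real.exp (1 - |x| / 2) := by
  rw [← integrableOn_univ, ← Iic_union_Ioi (a := (0 : ℝ))]
  refine IntegrableOn.union ?_ ?_
  · refine IntegrableOn.congr_fun ((integrableOn_exp_mul_Iic (a := 1 / 2) (by norm_num) 0).const_mul
      (Real.exp 1)) (fun x hx ↦ ?_) measurableSet_Iic
    simp only [← Real.exp_add, abs_of_nonpos (mem_Iic.1 hx)]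
    ring_nf
  · refine IntegrableOn.congr_fun ((integrableOn_exp_mul_Ioi (a := -1 / 2) (by norm_num) 0).const_mul
      (Real.exp 1)) (fun x hx ↦ ?_) measurableSet_Ioi
    simp only [← Real.exp_add, abs_of_pos (mem_Ioi.1 hx)]
    ring_nf

/-- The bilateral Laplace transform of `rampDiff`. -/
noncomputable def rampDiffLaplace (w : ℂ) : ℂ :=
  ∫ x : ℝ, Complex.exp (w * x) * (rampDiff x : ℂ)

lemma continuousAt_rampDiffLaplace {w : ℂ} (hw : w.re = 0) :
    ContinuousAt rampDiffLaplace w := by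
  refine continuousAt_of_dominated (bound := fun x ↦ Real.exp (1 - |x| / 2)) ?_ ?_
    integrable_exp_sub_half_abs ?_
  · exact .of_forall fun z ↦ (by fun_prop : Continuous _).aestronglyMeasurable
  · have : ∀ᶠ z : ℂ in 𝓝 w, |z.re| < 1 / 2 := by
      refine (by fun_prop : Continuous fun z : ℂ ↦ |z.re|).continuousAt.eventually_lt
        continuousAt_const ?_
      simp [hw]
    filter_upwards [this] with z hz
    refine .of_forall fun x ↦ ?_
    rw [norm_mul, Complex.norm_exp, Complex.norm_real, Real.norm_eq_abs]
    calc _ ≤ Real.exp (|x| / 2) * Real.exp (1 - |x|) := by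
          gcongr
          · have : z.re * x ≤ |z.re| * |x| := (le_abs_self _).trans (abs_mul _ _).le
            simp only [Complex.mul_re, Complex.ofReal_re, Complex.ofReal_im]
            nlinarith [abs_nonneg x]
          · exact abs_rampDiff_le x
      _ = _ := by rw [← Real.exp_add]; ring_nf
  · exact .of_forall fun x ↦ by fun_prop

lemma exp_smul_Gamma_integrand (w : ℂ) (x : ℝ) :
    |Real.exp x| • ((Real.exp (-Real.exp x) : ℂ) * (Real.exp x : ℂ) ^ (w - 1)) =
      Complex.exp (w * x) * (Real.exp (-Real.exp x) : ℂ) := by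
  have h : (Real.exp x : ℂ) ≠ 0 := by simp
  rw [abs_of_pos (Real.exp_pos x), Complex.real_smul, Complex.cpow_sub _ _ h, Complex.cpow_one,
    Complex.cpow_def_of_ne_zero h, ← Complex.ofReal_log (Real.exp_pos x).le, Real.log_exp,
    mul_comm (x : ℂ) w]
  field_simp

lemma integrable_exp_mul_exp_neg_exp {w : ℂ} (hw : 0 < w.re) :
    Integrable fun x : ℝ ↦ Complex.exp (w * x) * (Real.exp (-Real.exp x) : ℂ) := by
  have h := Complex.GammaIntegral_convergent hw
  rw [← Real.range_exp, ← image_univ, integrableOn_image_iff_integrableOn_abs_deriv_smul .univ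
    (fun x _ ↦ (Real.hasDerivAt_exp x).hasDerivWithinAt) Real.exp_injective.injOn,
    integrableOn_univ] at h
  simpa only [exp_smul_Gamma_integrand] using h

lemma integral_exp_mul_exp_neg_exp {w : ℂ} (hw : 0 < w.re) :
    ∫ x : ℝ, Complex.exp (w * x) * (Real.exp (-Real.exp x) : ℂ) = Complex.Gamma w := by
  rw [Complex.Gamma_eq_integral hw, Complex.GammaIntegral, ← Real.range_exp, ← image_univ,
    integral_image_eq_integral_abs_deriv_smul .univ
    (fun x _ ↦ (Real.hasDerivAt_exp x).hasDerivWithinAt) Real.exp_injective.injOn,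
    setIntegral_univ]
  simp only [exp_smul_Gamma_integrand]

lemma integrable_and_integral_exp_mul_ramp {w : ℂ} (hw : 0 < w.re) :
    Integrable (fun x : ℝ ↦ Complex.exp (w * x) * (ramp x : ℂ)) ∧
      ∫ x : ℝ, Complex.exp (w * x) * (ramp x : ℂ) = Complex.sinh w / w ^ 2 := by
  have hw0 : w ≠ 0 := by rintro rfl; simp at hw
  have hcont : Continuous fun x : ℝ ↦ Complex.exp (w * x) * (ramp x : ℂ) := by
    have := continuous_ramp
    fun_prop
  have hl : EqOn (fun x : ℝ ↦ Complex.exp (w * x)) (fun x ↦ Complex.exp (w * x) * (ramp x : ℂ))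
      (Iic (-1)) := fun x hx ↦ by simp [ramp_of_le (mem_Iic.1 hx)]
  have hr : EqOn (fun _ : ℝ ↦ (0 : ℂ)) (fun x ↦ Complex.exp (w * x) * (ramp x : ℂ))
      (Ioi 1) := fun x hx ↦ by simp [ramp_of_ge (mem_Ioi.1 hx).le]
  have il : IntegrableOn (fun x : ℝ ↦ Complex.exp (w * x) * (ramp x : ℂ)) (Iic (-1)) :=
    (integrableOn_exp_mul_complex_Iic hw (-1)).congr_fun hl measurableSet_Iic
  have im : IntegrableOn (fun x : ℝ ↦ Complex.exp (w * x) * (ramp x : ℂ)) (Ioc (-1) 1) :=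
    hcont.integrableOn_Ioc
  have ir : IntegrableOn (fun x : ℝ ↦ Complex.exp (w * x) * (ramp x : ℂ)) (Ioi 1) :=
    integrableOn_zero.congr_fun hr measurableSet_Ioi
  have ilm := il.union im
  rw [Iic_union_Ioc_eq_Iic (by norm_num)] at ilm
  have hi : Integrable fun x : ℝ ↦ Complex.exp (w * x) * (ramp x : ℂ) := by
    rw [← integrableOn_univ, ← Iic_union_Ioi (a := (1 : ℝ))]
    exact ilm.union ir
  refine ⟨hi, ?_⟩
  have hmid : ∫ x in (-1 : ℝ)..1, Complex.exp (w * x) * (ramp x : ℂ) =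
      Complex.exp w / (2 * w ^ 2) - (Complex.exp (-w) / w + Complex.exp (-w) / (2 * w ^ 2)) := by
    have hd : ∀ x ∈ uIcc (-1 : ℝ) 1, HasDerivAt
        (fun x : ℝ ↦ Complex.exp (w * x) * ((1 - x) / (2 * w) + 1 / (2 * w ^ 2)))
        (Complex.exp (w * x) * (ramp x : ℂ)) x := fun x hx ↦ by
      rw [uIcc_of_le (by norm_num)] at hx
      rw [ramp_of_mem hx.1 hx.2]
      have h1 : HasDerivAt (fun x : ℝ ↦ (x : ℂ)) 1 x := Complex.ofRealCLM.hasDerivAt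
      have h2 := (h1.const_mul w).cexp.mul
        (((h1.const_sub 1).div_const (2 * w)).add_const (1 / (2 * w ^ 2)))
      refine h2.congr_deriv ?_
      push_cast
      field_simp
      ring
    rw [intervalIntegral.integral_eq_sub_of_hasDerivAt hd (hcont.intervalIntegrable _ _)]
    push_cast
    rw [mul_one, mul_neg_one]
    field_simp
    ring
  rw [← setIntegral_univ, ← Iic_union_Ioi (a := (1 : ℝ)), setIntegral_union
    (Iic_disjoint_Ioi le_rfl) measurableSet_Ioi ilm ir, ← setIntegral_congr_fun measurableSet_Ioi hr,
    ← Iic_union_Ioc_eq_Iic (by norm_num : (-1 : ℝ) ≤ 1), setIntegral_union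
    (Iic_disjoint_Ioc le_rfl) measurableSet_Ioc il im,
    ← setIntegral_congr_fun measurableSet_Iic hl, integral_exp_mul_complex_Iic hw,
    ← intervalIntegral.integral_of_le (by norm_num), hmid, Complex.sinh]
  push_cast
  rw [mul_neg_one]
  simp
  field_simp
  ring

lemma rampDiffLaplace_eq {w : ℂ} (hw : 0 < w.re) :
    rampDiffLaplace w = Complex.Gamma w - Complex.sinh w / w ^ 2 := by
  obtain ⟨hi, he⟩ := integrable_and_integral_exp_mul_ramp hw
  rw [← he, ← integral_exp_mul_exp_neg_exp hw,
    ← integral_sub (integrable_exp_mul_exp_neg_exp hw) hi]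
  simp only [rampDiffLaplace, rampDiff, Complex.ofReal_sub, mul_sub]

lemma tendsto_rampDiffLaplace {s : ℂ} (hs : s.re = 0) :
    Tendsto (fun ε : ℝ ↦ Complex.Gamma (s + ε) - Complex.sinh (s + ε) / (s + ε) ^ 2)
      (𝓝[>] 0) (𝓝 (rampDiffLaplace s)) := by
  have h1 : Tendsto (fun ε : ℝ ↦ s + ε) (𝓝[>] 0) (𝓝 s) := by
    have : ContinuousAt (fun ε : ℝ ↦ s + ε) 0 := by fun_prop
    simpa [ContinuousAt] using this.tendsto.mono_left nhdsWithin_le_nhds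
  refine ((continuousAt_rampDiffLaplace hs).tendsto.comp h1).congr' ?_
  filter_upwards [self_mem_nhdsWithin] with ε hε
  exact rampDiffLaplace_eq (by simpa [hs] using hε)

lemma rampDiffLaplace_of_sinh_eq_zero {s : ℂ} (hs : s.re = 0) (hs0 : s ≠ 0)
    (hsinh : Complex.sinh s = 0) : rampDiffLaplace s = Complex.Gamma s := by
  refine tendsto_nhds_unique (tendsto_rampDiffLaplace hs) ?_
  have hG : ContinuousAt Complex.Gamma s := by
    refine (Complex.differentiableAt_Gamma s fun m hm ↦ hs0 ?_).continuousAt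
    have : m = 0 := by simpa [hs] using congrArg Complex.re hm
    simpa [this] using hm
  have hF : ContinuousAt (fun z ↦ Complex.Gamma z - Complex.sinh z / z ^ 2) s :=
    hG.sub (Complex.continuous_sinh.continuousAt.div (by fun_prop) (pow_ne_zero 2 hs0))
  have h1 : Tendsto (fun ε : ℝ ↦ s + ε) (𝓝[>] 0) (𝓝 s) := by
    have : ContinuousAt (fun ε : ℝ ↦ s + ε) 0 := by fun_prop
    simpa [ContinuousAt] using this.tendsto.mono_left nhdsWithin_le_nhds
  simpa [Function.comp_def, hsinh] using hF.tendsto.comp h1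

lemma tendsto_one_sub_sinh_div_sq :
    Tendsto (fun z : ℂ ↦ (1 - Complex.sinh z / z) / z) (𝓝[≠] 0) (𝓝 0) := by
  have h0 : Tendsto (fun z : ℂ ↦ ‖z‖) (𝓝[≠] 0) (𝓝 0) := by
    simpa using (continuous_norm (E := ℂ)).continuousAt.tendsto.mono_left
      (nhdsWithin_le_nhds (a := (0 : ℂ)) (s := {0}ᶜ))
  refine squeeze_zero_norm' ?_ h0
  filter_upwards [self_mem_nhdsWithin, h0.eventually_lt_const one_pos] with z hz hz1
  have hz0 : z ≠ 0 := hz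
  have e1 := Complex.exp_bound hz1.le (n := 3) (by norm_num)
  have e2 := Complex.exp_bound (x := -z) (by simpa using hz1.le) (n := 3) (by norm_num)
  have key : (1 - Complex.sinh z / z) / z =
      ((Complex.exp (-z) - ∑ m ∈ Finset.range 3, (-z) ^ m / m.factorial) -
        (Complex.exp z - ∑ m ∈ Finset.range 3, z ^ m / m.factorial)) / (2 * z ^ 2) := by
    simp only [Complex.sinh, Finset.sum_range_succ, Finset.sum_range_zero, Nat.factorial]
    field_simp
    push_cast
    ring
  have hpos : 0 < ‖z‖ := norm_pos_iff.2 hz0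
  rw [key, norm_div, norm_mul, norm_pow, Complex.norm_ofNat, div_le_iff₀ (by positivity)]
  refine (norm_sub_le _ _).trans ((add_le_add e2 e1).trans ?_)
  norm_num [Nat.factorial]
  nlinarith [pow_pos hpos 3]

lemma rampDiffLaplace_zero : rampDiffLaplace 0 = -Real.eulerMascheroniConstant := by
  refine tendsto_nhds_unique (tendsto_rampDiffLaplace Complex.zero_re) ?_
  have h1 : Tendsto (fun ε : ℝ ↦ (ε : ℂ)) (𝓝[>] 0) (𝓝[≠] 0) := by
    refine tendsto_nhdsWithin_iff.2 ⟨?_, ?_⟩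
    · have : ContinuousAt (fun ε : ℝ ↦ (ε : ℂ)) 0 := by fun_prop
      simpa [ContinuousAt] using this.tendsto.mono_left nhdsWithin_le_nhds
    · filter_upwards [self_mem_nhdsWithin] with ε hε
      simpa using (ne_of_gt hε)
  have h2 := (hasDerivAt_iff_tendsto_slope_zero.1 Complex.hasDerivAt_Gamma_one)
  have h3 := ((h2.add tendsto_one_sub_sinh_div_sq).comp h1)
  rw [add_zero] at h3
  refine h3.congr' ?_
  filter_upwards [self_mem_nhdsWithin] with ε hε
  have hε0 : (ε : ℂ) ≠ 0 := by simpa using (ne_of_gt hε)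
  simp only [Function.comp_apply, zero_add, smul_eq_mul, Complex.Gamma_one]
  rw [add_comm 1 (ε : ℂ), Complex.Gamma_add_one _ hε0]
  field_simp
  ring

lemma fourier_rampDiff_comp_two_mul (n : ℤ) :
    𝓕 (fun t : ℝ ↦ (rampDiff (2 * t) : ℂ)) (n : ℝ) =
      rampDiffLaplace (-(Real.pi * Complex.I * n)) / 2 := by
  rw [Real.fourier_real_eq_integral_exp_smul]
  have h := Measure.integral_comp_mul_left
    (fun x : ℝ ↦ Complex.exp (-(Real.pi * Complex.I * n) * x) * (rampDiff x : ℂ)) 2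
  rw [show rampDiffLaplace (-(Real.pi * Complex.I * n)) / 2 = |(2 : ℝ)⁻¹| • ∫ x : ℝ,
      Complex.exp (-(Real.pi * Complex.I * n) * x) * (rampDiff x : ℂ) by
    rw [rampDiffLaplace, abs_of_pos (by norm_num), Complex.real_smul]; push_cast; ring, ← h]
  congr 1
  ext t
  rw [smul_eq_mul]
  push_cast
  ring_nf

lemma rampDiffLaplace_pi_mul_I {n : ℤ} (hn : n ≠ 0) :
    rampDiffLaplace (Real.pi * Complex.I * n) = Complex.Gamma (Real.pi * Complex.I * n) := by
  refine rampDiffLaplace_of_sinh_eq_zero (by simp) (by simp [hn, Real.pi_ne_zero]) ?_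
  rw [show (Real.pi * Complex.I * n : ℂ) = (n * Real.pi : ℂ) * Complex.I by ring,
    Complex.sinh_mul_I, Complex.sin_int_mul_pi, zero_mul]

lemma norm_Gamma_le_Gamma_re {s : ℂ} (hs : 0 < s.re) : ‖Complex.Gamma s‖ ≤ Real.Gamma s.re := by
  rw [Complex.Gamma_eq_integral hs, Real.Gamma_eq_integral hs, Complex.GammaIntegral]
  refine (norm_integral_le_integral_norm _).trans_eq (setIntegral_congr_fun measurableSet_Ioi ?_)
  intro x hx
  simp only [norm_mul, Complex.norm_real, Complex.norm_cpow_eq_rpow_re_of_pos hx, Real.norm_eq_abs,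
    Real.abs_exp, Complex.sub_re, Complex.one_re]

lemma norm_Gamma_ofReal_mul_I_le {y : ℝ} (hy : y ≠ 0) :
    ‖Complex.Gamma (y * Complex.I)‖ ≤ 1 / y ^ 2 := by
  have h0 : (y * Complex.I : ℂ) ≠ 0 := by simp [hy]
  have h1 : (y * Complex.I + 1 : ℂ) ≠ 0 := fun h ↦ by simpa using congrArg Complex.re h
  have h := norm_Gamma_le_Gamma_re (s := y * Complex.I + 1 + 1) (by simp)
  rw [Complex.Gamma_add_one _ h1, Complex.Gamma_add_one _ h0, norm_mul, norm_mul] at h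
  have hre : (y * Complex.I + 1 + 1 : ℂ).re = 2 := by simp; norm_num
  have hn : |y| ≤ ‖(y * Complex.I + 1 : ℂ)‖ := by
    simpa using Complex.abs_im_le_norm (y * Complex.I + 1)
  rw [hre, Real.Gamma_two, norm_mul, Complex.norm_I, mul_one, Complex.norm_real,
    Real.norm_eq_abs] at h
  rw [le_div_iff₀ (by positivity), ← sq_abs]
  have := mul_le_mul_of_nonneg_right hn
    (mul_nonneg (abs_nonneg y) (norm_nonneg (Complex.Gamma (y * Complex.I))))
  linarith

lemma norm_rampDiffLaplace_pi_mul_I_le {n : ℤ} (hn : n ≠ 0) :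
    ‖rampDiffLaplace (Real.pi * Complex.I * n)‖ ≤ 1 / (n : ℝ) ^ 2 := by
  have hn' : (n : ℝ) ≠ 0 := by exact_mod_cast hn
  have h := norm_Gamma_ofReal_mul_I_le (y := Real.pi * n) (mul_ne_zero Real.pi_ne_zero hn')
  rw [rampDiffLaplace_pi_mul_I hn]
  calc _ = ‖Complex.Gamma (((Real.pi * n : ℝ) : ℂ) * Complex.I)‖ := by push_cast; ring_nf
    _ ≤ _ := h
    _ ≤ _ := by
      have : (1 : ℝ) ≤ Real.pi ^ 2 := one_le_pow₀ (by linarith [Real.pi_gt_three])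
      rw [mul_pow]
      gcongr
      nlinarith [sq_nonneg (n : ℝ)]

lemma summable_rampDiffLaplace :
    Summable fun n : ℤ ↦ rampDiffLaplace (Real.pi * Complex.I * n) := by
  refine summable_of_isBigO (Real.summable_one_div_int_pow.2 one_lt_two) (.of_bound 1 ?_)
  filter_upwards [(finite_singleton (0 : ℤ)).compl_mem_cofinite] with n hn
  rw [one_mul, Real.norm_of_nonneg (by positivity)]
  exact norm_rampDiffLaplace_pi_mul_I_le hn

lemma isBigO_rampDiff_comp_two_mul :
    (fun t : ℝ ↦ (rampDiff (2 * t) : ℂ)) =O[cocompact ℝ] fun t ↦ |t| ^ (-2 : ℝ) := by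
  have hx : ∀ᶠ t : ℝ in cocompact ℝ, t ≠ 0 :=
    (isCompact_singleton (x := (0 : ℝ))).compl_mem_cocompact
  refine .of_bound (Real.exp 1) ?_
  filter_upwards [hx] with t ht
  have ht' : 0 < |t| := abs_pos.2 ht
  rw [Complex.norm_real, Real.norm_eq_abs, Real.norm_of_nonneg (by positivity),
    Real.rpow_neg ht'.le, Real.rpow_two]
  refine (abs_rampDiff_le _).trans ?_
  rw [sub_eq_add_neg, Real.exp_add, abs_mul, abs_two, Real.exp_neg]
  gcongr
  have := Real.quadratic_le_exp_of_nonneg (x := 2 * |t|) (by positivity)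
  nlinarith

lemma tsum_rampDiff_eq :
    ∑' n : ℤ, (rampDiff (2 * n + 1) : ℂ) =
      ∑' n : ℤ, (-1 : ℂ) ^ n * rampDiffLaplace (Real.pi * Complex.I * n) / 2 := by
  have hF (n : ℤ) := fourier_rampDiff_comp_two_mul n
  have hs : Summable fun n : ℤ ↦ 𝓕 (fun t : ℝ ↦ (rampDiff (2 * t) : ℂ)) (n : ℝ) := by
    simp only [hF]
    have := (Equiv.neg ℤ).summable_iff.2 summable_rampDiffLaplace
    simpa [Function.comp_def] using this.div_const 2
  have h := Real.tsum_eq_tsum_fourier_of_rpow_decay_of_summable (by fun_prop) one_lt_two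
    isBigO_rampDiff_comp_two_mul hs (1 / 2)
  have hl : ∑' n : ℤ, (rampDiff (2 * n + 1) : ℂ) =
      ∑' n : ℤ, (rampDiff (2 * (1 / 2 + n)) : ℂ) := by
    refine tsum_congr fun n ↦ ?_
    congr 2
    ring
  rw [hl, h, ← (Equiv.neg ℤ).tsum_eq (fun n : ℤ ↦
    (-1 : ℂ) ^ n * rampDiffLaplace (Real.pi * Complex.I * n) / 2)]
  refine tsum_congr fun n ↦ ?_
  have he : Complex.exp (2 * Real.pi * Complex.I * n * (1 / 2 : ℝ) / (1 : ℝ)) = (-1 : ℂ) ^ n := by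
    rw [← Complex.exp_pi_mul_I, ← Complex.exp_int_mul]
    push_cast
    ring_nf
  rw [hF, fourier_coe_apply, he, Equiv.neg_apply, zpow_neg, ← inv_zpow, inv_neg_one, Int.cast_neg,
    mul_neg]
  ring

lemma summable_rampDiff : Summable fun n : ℤ ↦ rampDiff (2 * n + 1) := by
  refine summable_of_isBigO (Real.summable_one_div_int_pow.2 one_lt_two)
    (.of_bound (Real.exp 2) ?_)
  filter_upwards [(finite_singleton (0 : ℤ)).compl_mem_cofinite] with n hn
  have hn' : (n : ℝ) ≠ 0 := by exact_mod_cast hn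
  have hp : 0 < |(n : ℝ)| := abs_pos.2 hn'
  rw [Real.norm_eq_abs, Real.norm_of_nonneg (by positivity), one_div, ← sq_abs]
  refine (abs_rampDiff_le _).trans ?_
  have h1 : 2 * |(n : ℝ)| ≤ |2 * (n : ℝ) + 1| + 1 := by
    have := abs_add_le (2 * (n : ℝ) + 1) (-1)
    simpa [abs_mul] using this
  calc Real.exp (1 - |2 * (n : ℝ) + 1|) ≤ Real.exp (2 + -(2 * |(n : ℝ)|)) :=
        Real.exp_le_exp.2 (by linarith)
    _ ≤ _ := by
      rw [Real.exp_add, Real.exp_neg]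
      gcongr
      have := Real.quadratic_le_exp_of_nonneg (x := 2 * |(n : ℝ)|) (by positivity)
      nlinarith

lemma tsum_one_sub_exp_neg_exp :
    ∑' n : ℕ, (1 - Real.exp (-Real.exp (-(2 * n + 1)))) =
      ∑' k : ℕ, (-1 : ℝ) ^ k / (k + 1).factorial * (1 / (2 * Real.sinh (k + 1))) := by
  set F : ℕ → ℕ → ℝ := fun n k ↦
    (-1) ^ k / (k + 1).factorial * Real.exp (-((k + 1) * (2 * n + 1))) with hF
  have hrow (n : ℕ) : HasSum (F n) (1 - Real.exp (-Real.exp (-(2 * n + 1)))) := by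
    have h := (NormedSpace.expSeries_div_hasSum_exp (-Real.exp (-(2 * (n : ℝ) + 1))))
    rw [← Real.exp_eq_exp_ℝ, ← hasSum_nat_add_iff' 1] at h
    have e1 : F n = fun k ↦ -((-Real.exp (-(2 * (n : ℝ) + 1))) ^ (k + 1) / (k + 1).factorial) := by
      ext k
      have : Real.exp (-((k + 1) * (2 * n + 1))) = Real.exp (-(2 * (n : ℝ) + 1)) ^ (k + 1) := by
        rw [← Real.exp_nat_mul]
        push_cast
        ring_nf
      simp only [hF]
      rw [this, neg_pow (Real.exp _), pow_succ (-1 : ℝ) k]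
      ring
    rw [e1]
    simpa using h.neg
  have hcol (k : ℕ) : HasSum (fun n ↦ F n k)
      ((-1 : ℝ) ^ k / (k + 1).factorial * (1 / (2 * Real.sinh (k + 1)))) := by
    refine HasSum.mul_left _ ?_
    have hlt : Real.exp (-(2 * (k + 1))) < 1 := Real.exp_lt_one_iff.2
      (by linarith [k.cast_nonneg (α := ℝ)])
    have h := (hasSum_geometric_of_lt_one (Real.exp_pos (-(2 * ((k : ℝ) + 1)))).le hlt).mul_left
      (Real.exp (-((k : ℝ) + 1)))
    have e1 : (fun n : ℕ ↦ Real.exp (-(((k : ℝ) + 1) * (2 * n + 1)))) = fun n : ℕ ↦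
        Real.exp (-((k : ℝ) + 1)) * Real.exp (-(2 * ((k : ℝ) + 1))) ^ n := by
      ext n
      rw [← Real.exp_nat_mul, ← Real.exp_add]
      ring_nf
    have e2 : 1 / (2 * Real.sinh ((k : ℝ) + 1)) =
        Real.exp (-((k : ℝ) + 1)) * (1 - Real.exp (-(2 * ((k : ℝ) + 1))))⁻¹ := by
      have hE : 1 < Real.exp ((k : ℝ) + 1) := Real.one_lt_exp_iff.2 (by positivity)
      rw [Real.sinh_eq, two_mul ((k : ℝ) + 1), neg_add ((k : ℝ) + 1), Real.exp_add (-_),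
        Real.exp_neg]
      set E := Real.exp ((k : ℝ) + 1)
      have h1 : E ^ 2 - 1 ≠ 0 := by nlinarith
      have h2 : 1 - E⁻¹ * E⁻¹ = (E ^ 2 - 1) / E ^ 2 := by field_simp
      have h3 : 2 * ((E - E⁻¹) / 2) = (E ^ 2 - 1) / E := by field_simp
      rw [h2, h3]
      field_simp
    rw [e1, e2]
    exact h
  have hsum : Summable (Function.uncurry F) := by
    have hg : Summable fun n : ℕ ↦ Real.exp (-2) ^ n :=
      summable_geometric_of_lt_one (Real.exp_pos _).le (Real.exp_lt_one_iff.2 (by norm_num))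
    have hf : Summable fun k : ℕ ↦ (1 : ℝ) ^ (k + 1) / (k + 1).factorial :=
      (summable_nat_add_iff 1).2 (Real.summable_pow_div_factorial 1)
    refine Summable.of_norm_bounded (hg.mul_of_nonneg hf (fun n ↦ by positivity)
      (fun k ↦ by positivity)) ?_
    rintro ⟨n, k⟩
    simp only [Function.uncurry, hF, norm_mul, norm_div, norm_pow, norm_neg, norm_one, one_pow,
      Real.norm_eq_abs, Real.abs_exp, Nat.abs_cast]
    rw [mul_comm, ← Real.exp_nat_mul]
    gcongr
    nlinarith [n.cast_nonneg (α := ℝ), k.cast_nonneg (α := ℝ),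
      mul_nonneg (n.cast_nonneg (α := ℝ)) (k.cast_nonneg (α := ℝ))]
  rw [← tsum_congr fun n ↦ (hrow n).tsum_eq, ← tsum_congr fun k ↦ (hcol k).tsum_eq]
  exact hsum.tsum_comm.symm

lemma tsum_rampDiff_odd :
    ∑' n : ℤ, rampDiff (2 * n + 1) = ∑' k : ℕ, Real.exp (-Real.exp (2 * k + 1)) -
      ∑' k : ℕ, (-1 : ℝ) ^ k / (k + 1).factorial * (1 / (2 * Real.sinh (k + 1))) := by
  have h1 : Summable fun n : ℕ ↦ rampDiff (2 * ((n : ℤ) : ℝ) + 1) :=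
    summable_rampDiff.comp_injective Nat.cast_injective
  have h2 : Summable fun n : ℕ ↦ rampDiff (2 * ((-((n : ℤ) + 1) : ℤ) : ℝ) + 1) :=
    summable_rampDiff.comp_injective (i := fun n : ℕ ↦ -((n : ℤ) + 1)) fun a b h ↦ by simpa using h
  have e1 (n : ℕ) : rampDiff (2 * ((n : ℤ) : ℝ) + 1) = Real.exp (-Real.exp (2 * n + 1)) := by
    have : (1 : ℝ) ≤ 2 * n + 1 := by linarith [n.cast_nonneg (α := ℝ)]
    simp [rampDiff, ramp_of_ge this]
  have e2 (n : ℕ) : rampDiff (2 * ((-((n : ℤ) + 1) : ℤ) : ℝ) + 1) =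
      -(1 - Real.exp (-Real.exp (-(2 * n + 1)))) := by
    have h : (2 * ((-((n : ℤ) + 1) : ℤ) : ℝ) + 1) = -(2 * n + 1) := by push_cast; ring
    rw [h, rampDiff, ramp_of_le (by linarith [n.cast_nonneg (α := ℝ)])]
    ring
  have h := tsum_of_nat_of_neg_add_one (f := fun n : ℤ ↦ rampDiff (2 * (n : ℝ) + 1)) h1 h2
  simp only [e1, e2] at h
  rw [h, tsum_neg, tsum_one_sub_exp_neg_exp, sub_eq_add_neg]

lemma tsum_neg_one_zpow_mul_rampDiffLaplace :
    ∑' n : ℤ, (-1 : ℂ) ^ n * rampDiffLaplace (Real.pi * Complex.I * n) / 2 =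
      ((-Real.eulerMascheroniConstant / 2 + ∑' k : ℕ+, (-1 : ℝ) ^ (k : ℕ) *
        (Complex.Gamma (Real.pi * Complex.I * (k : ℕ))).re : ℝ) : ℂ) := by
  have hs : Summable fun n : ℤ ↦
      (-1 : ℂ) ^ n * rampDiffLaplace (Real.pi * Complex.I * n) / 2 := by
    have h : Summable fun n : ℤ ↦
        (-1 : ℂ) ^ n * rampDiffLaplace (Real.pi * Complex.I * n) := by
      refine Summable.of_norm ?_
      simpa only [norm_mul, norm_zpow, norm_neg, norm_one, one_zpow, one_mul] using
        summable_rampDiffLaplace.norm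
    exact h.div_const 2
  have hp : Summable fun k : ℕ+ ↦
      (-1 : ℂ) ^ ((k : ℕ) : ℤ) * rampDiffLaplace (Real.pi * Complex.I * ((k : ℕ) : ℤ)) / 2 :=
    hs.comp_injective (i := fun k : ℕ+ ↦ ((k : ℕ) : ℤ)) fun a b h ↦ by simpa using h
  have hn : Summable fun k : ℕ+ ↦ (-1 : ℂ) ^ (-((k : ℕ) : ℤ)) *
      rampDiffLaplace (Real.pi * Complex.I * (-((k : ℕ) : ℤ) : ℤ)) / 2 :=
    hs.comp_injective (i := fun k : ℕ+ ↦ -((k : ℕ) : ℤ)) fun a b h ↦ by simpa using h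
  rw [tsum_int_eq_zero_add_tsum_pnat hs, add_assoc, ← hp.tsum_add hn]
  push_cast
  congr 1
  · simp [rampDiffLaplace_zero]
  · refine tsum_congr fun k ↦ ?_
    have hk : ((k : ℕ) : ℤ) ≠ 0 := by simp
    have e1 := rampDiffLaplace_pi_mul_I hk
    have e2 := rampDiffLaplace_pi_mul_I (neg_ne_zero.2 hk)
    have e3 : Complex.Gamma (Real.pi * Complex.I * (-((k : ℕ) : ℤ) : ℤ)) =
        (starRingEnd ℂ) (Complex.Gamma (Real.pi * Complex.I * (k : ℕ))) := by
      rw [← Complex.Gamma_conj]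
      simp
    rw [e3] at e2
    push_cast at e1 e2 ⊢
    rw [e1, e2, zpow_neg, ← inv_zpow, inv_neg_one, zpow_natCast, Complex.re_eq_add_conj]
    ring

/-- Euler's constant satisfies
`γ = −2·Σ_{k≥0} exp(−e^{2k+1}) + Σ_{k≥1} ((−1)^{k+1}/k!)·(1/sinh k)
   − 2·Σ_{k≥1} (−1)^{k+1}·Re(Γ(πik))`. -/
theorem gamma_formula_one :
    Real.eulerMascheroniConstant =
      -2 * ∑' k : ℕ, Real.exp (-Real.exp (2 * k + 1))
      + ∑' k : ℕ+, (-1 : ℝ) ^ ((k : ℕ) + 1) / (Nat.factorial k) * (1 / Real.sinh k)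
      - 2 * ∑' k : ℕ+, (-1 : ℝ) ^ ((k : ℕ) + 1) *
          (Complex.Gamma (Real.pi * Complex.I * (k : ℕ))).re := by
  have h := tsum_rampDiff_eq
  rw [tsum_neg_one_zpow_mul_rampDiffLaplace, ← Complex.ofReal_tsum, Complex.ofReal_inj,
    tsum_rampDiff_odd] at h
  have h1 : ∑' k : ℕ+, (-1 : ℝ) ^ ((k : ℕ) + 1) / (Nat.factorial k) * (1 / Real.sinh k) =
      2 * ∑' k : ℕ, (-1 : ℝ) ^ k / (k + 1).factorial * (1 / (2 * Real.sinh (k + 1))) := by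
    rw [tsum_pnat_eq_tsum_succ (f := fun k : ℕ ↦
      (-1 : ℝ) ^ (k + 1) / (Nat.factorial k) * (1 / Real.sinh k)), ← tsum_mul_left]
    refine tsum_congr fun k ↦ ?_
    push_cast
    rw [pow_add, pow_add]
    field_simp
  have h2 : ∑' k : ℕ+, (-1 : ℝ) ^ ((k : ℕ) + 1) *
      (Complex.Gamma (Real.pi * Complex.I * (k : ℕ))).re =
      -∑' k : ℕ+, (-1 : ℝ) ^ (k : ℕ) * (Complex.Gamma (Real.pi * Complex.I * (k : ℕ))).re := by
    rw [← tsum_neg]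
    refine tsum_congr fun k ↦ ?_
    ring
  rw [h1, h2]
  linarith
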